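/- Let n ≥ 3, u a positive C² function on an open set of ℝⁿ, x₀ ∈ ℝⁿ, λ > 0, and define the Kelvin transform u_{x₀,λ}(y) = (λ^{n-2}/|y - x₀|^{n-2}) u(x₀ + λ²(y - x₀)/|y - x₀|²) for y ≠ x₀ with the inverted point in the domain of u. Then at every such y, the eigenvalues of -A^{u_{x₀,λ}}(y) coincide (as a multiset) with the eigenvalues of -A^{u} evaluated at the inverted point ξ = x₀ + λ²(y - x₀)/|y - x₀|². -/

import Mathlib

open Real Matrix Filter

noncomputable def pgrad (n : ℕ) (u : EuclideanSpace ℝ (Fin n) → ℝ)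
    (x : EuclideanSpace ℝ (Fin n)) (i : Fin n) : ℝ :=
  fderiv ℝ u x (EuclideanSpace.single i 1)

noncomputable def phess (n : ℕ) (u : EuclideanSpace ℝ (Fin n) → ℝ)
    (x : EuclideanSpace ℝ (Fin n)) (i j : Fin n) : ℝ :=
  fderiv ℝ (fun y => fderiv ℝ u y (EuclideanSpace.single j 1)) x (EuclideanSpace.single i 1)

/-- The conformal Hessian `A^u` of a positive function `u`. -/
noncomputable def confHess (n : ℕ) (u : EuclideanSpace ℝ (Fin n) → ℝ)
    (x : EuclideanSpace ℝ (Fin n)) : Matrix (Fin n) (Fin n) ℝ :=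
  Matrix.of fun i j =>
    -(2 / ((n : ℝ) - 2)) * (u x) ^ (-(((n : ℝ) + 2) / ((n : ℝ) - 2))) * phess n u x i j
    + (2 * (n : ℝ) / ((n : ℝ) - 2) ^ 2) * (u x) ^ (-(2 * (n : ℝ) / ((n : ℝ) - 2))) *
        pgrad n u x i * pgrad n u x j
    - (2 / ((n : ℝ) - 2) ^ 2) * (u x) ^ (-(2 * (n : ℝ) / ((n : ℝ) - 2))) *
        (∑ k, (pgrad n u x k) ^ 2) * (if i = j then (1 : ℝ) else 0)

section KelvinAux
variable {E : Type*} [NormedAddCommGroup E] [InnerProductSpace ℝ E]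

theorem line_sq (y a x₀ : E) :
    HasDerivAt (fun t : ℝ => ‖y + t • a - x₀‖ ^ 2) (2 * inner ℝ (y - x₀) a) 0 := by
  have h : HasDerivAt (fun t : ℝ => y + t • a - x₀) a 0 := by
    simpa using (((hasDerivAt_id (0:ℝ)).smul_const a).const_add y).sub_const x₀
  simpa using h.norm_sq

theorem line_M (p : ℕ) (lam : ℝ) (y a x₀ : E) (hy : y ≠ x₀) :
    HasDerivAt (fun t : ℝ => lam ^ p / ‖y + t • a - x₀‖ ^ p)
      (-(p * (lam ^ p / ‖y - x₀‖ ^ p) * inner ℝ (y - x₀) a / ‖y - x₀‖ ^ 2)) 0 := by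
  have hr : ‖y - x₀‖ ≠ 0 := norm_ne_zero_iff.2 (sub_ne_zero.2 hy)
  have h1 : HasDerivAt (fun t : ℝ => ‖y + t • a - x₀‖) (inner ℝ (y - x₀) a / ‖y - x₀‖) 0 := by
    have := (line_sq y a x₀).sqrt (by simpa using hr)
    simp only [Real.sqrt_sq (norm_nonneg _)] at this
    refine this.congr_deriv ?_
    simp
    field_simp
  have h2 := (h1.fun_pow p).fun_inv (by simpa using pow_ne_zero p hr)
  have h3 := h2.const_mul (lam ^ p)
  simp only [div_eq_mul_inv] at h3 ⊢
  refine h3.congr_deriv ?_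
  simp only [zero_smul, add_zero]
  rcases p with _ | p
  · simp
  · simp only [Nat.add_sub_cancel]
    field_simp
    ring

theorem line_phi (lam : ℝ) (y a x₀ : E) (hy : y ≠ x₀) :
    HasDerivAt (fun t : ℝ => x₀ + (lam ^ 2 / ‖y + t • a - x₀‖ ^ 2) • (y + t • a - x₀))
      ((lam ^ 2 / ‖y - x₀‖ ^ 2) • (a - (2 * inner ℝ (y - x₀) a / ‖y - x₀‖ ^ 2) • (y - x₀))) 0 := by
  have h : HasDerivAt (fun t : ℝ => y + t • a - x₀) a 0 := by
    simpa using (((hasDerivAt_id (0:ℝ)).smul_const a).const_add y).sub_const x₀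
  have := ((line_M 2 lam y a x₀ hy).fun_smul h).const_add x₀
  refine this.congr_deriv ?_
  simp only [zero_smul, add_zero]
  push_cast
  module

/-- first derivative formula -/
noncomputable def Fd (p : ℕ) (lam : ℝ) (x₀ : E) (u : E → ℝ) (b y : E) : ℝ :=
  (lam ^ p / ‖y - x₀‖ ^ p) *
    (-(p * inner ℝ (y - x₀) b / ‖y - x₀‖ ^ 2 * u (x₀ + (lam ^ 2 / ‖y - x₀‖ ^ 2) • (y - x₀)))
      + lam ^ 2 / ‖y - x₀‖ ^ 2 *
        (fderiv ℝ u (x₀ + (lam ^ 2 / ‖y - x₀‖ ^ 2) • (y - x₀)) b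
          - 2 * inner ℝ (y - x₀) b / ‖y - x₀‖ ^ 2 *
            fderiv ℝ u (x₀ + (lam ^ 2 / ‖y - x₀‖ ^ 2) • (y - x₀)) (y - x₀)))

theorem line_u (lam : ℝ) (y a x₀ : E) (hy : y ≠ x₀) (u : E → ℝ)
    (hu : DifferentiableAt ℝ u (x₀ + (lam ^ 2 / ‖y - x₀‖ ^ 2) • (y - x₀))) :
    HasDerivAt (fun t : ℝ => u (x₀ + (lam ^ 2 / ‖y + t • a - x₀‖ ^ 2) • (y + t • a - x₀)))
      (lam ^ 2 / ‖y - x₀‖ ^ 2 *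
        (fderiv ℝ u (x₀ + (lam ^ 2 / ‖y - x₀‖ ^ 2) • (y - x₀)) a
          - 2 * inner ℝ (y - x₀) a / ‖y - x₀‖ ^ 2 *
            fderiv ℝ u (x₀ + (lam ^ 2 / ‖y - x₀‖ ^ 2) • (y - x₀)) (y - x₀))) 0 := by
  have h1 := line_phi lam y a x₀ hy
  have h2 := HasFDerivAt.comp_hasDerivAt_of_eq (0:ℝ) hu.hasFDerivAt h1 (by simp)
  refine h2.congr_deriv ?_
  simp

theorem first_line (p : ℕ) (lam : ℝ) (y a x₀ : E) (hy : y ≠ x₀) (u : E → ℝ)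
    (hu : DifferentiableAt ℝ u (x₀ + (lam ^ 2 / ‖y - x₀‖ ^ 2) • (y - x₀))) :
    HasDerivAt (fun t : ℝ => (lam ^ p / ‖y + t • a - x₀‖ ^ p) *
      u (x₀ + (lam ^ 2 / ‖y + t • a - x₀‖ ^ 2) • (y + t • a - x₀))) (Fd p lam x₀ u a y) 0 := by
  refine ((line_M p lam y a x₀ hy).fun_mul (line_u lam y a x₀ hy u hu)).congr_deriv ?_
  simp only [zero_smul, add_zero, Fd]
  ring

theorem contDiff_w (p : ℕ) (lam : ℝ) (y x₀ : E) (hy : y ≠ x₀) (u : E → ℝ)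
    (hu : ContDiffAt ℝ 2 u (x₀ + (lam ^ 2 / ‖y - x₀‖ ^ 2) • (y - x₀))) :
    ContDiffAt ℝ 2 (fun z => (lam ^ p / ‖z - x₀‖ ^ p) *
      u (x₀ + (lam ^ 2 / ‖z - x₀‖ ^ 2) • (z - x₀))) y := by
  have hz : y - x₀ ≠ 0 := sub_ne_zero.2 hy
  have hr : ‖y - x₀‖ ≠ 0 := norm_ne_zero_iff.2 hz
  have hs : ContDiffAt ℝ 2 (fun z : E => z - x₀) y := contDiffAt_id.sub contDiffAt_const
  have hN : ContDiffAt ℝ 2 (fun z : E => ‖z - x₀‖) y := hs.norm ℝ hz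
  have hM : ∀ q : ℕ, ContDiffAt ℝ 2 (fun z : E => lam ^ q / ‖z - x₀‖ ^ q) y := fun q =>
    contDiffAt_const.div (hN.pow q) (pow_ne_zero q hr)
  refine (hM p).mul ?_
  have hphi : ContDiffAt ℝ 2 (fun z : E => x₀ + (lam ^ 2 / ‖z - x₀‖ ^ 2) • (z - x₀)) y :=
    contDiffAt_const.add ((hM 2).smul hs)
  exact ContDiffAt.comp y hu hphi

theorem first_fderiv (p : ℕ) (lam : ℝ) (y a x₀ : E) (hy : y ≠ x₀) (u : E → ℝ)
    (hu : ContDiffAt ℝ 2 u (x₀ + (lam ^ 2 / ‖y - x₀‖ ^ 2) • (y - x₀))) :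
    fderiv ℝ (fun z => (lam ^ p / ‖z - x₀‖ ^ p) *
      u (x₀ + (lam ^ 2 / ‖z - x₀‖ ^ 2) • (z - x₀))) y a = Fd p lam x₀ u a y := by
  have h := (contDiff_w p lam y x₀ hy u hu).differentiableAt (by norm_num)
  rw [← h.lineDeriv_eq_fderiv]
  exact (first_line p lam y a x₀ hy u (hu.differentiableAt (by norm_num))).deriv

theorem line_Fd (p : ℕ) (lam : ℝ) (y a b x₀ : E) (hy : y ≠ x₀) (u : E → ℝ)
    (ξ : E) (hξ : ξ = x₀ + (lam ^ 2 / ‖y - x₀‖ ^ 2) • (y - x₀))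
    (hu : ContDiffAt ℝ 2 u ξ) (H : E → E → ℝ) (hH : H = fun a b => fderiv ℝ (fderiv ℝ u) ξ a b)
    (s za zb : ℝ) (hs : s = ‖y - x₀‖ ^ 2) (hza : za = inner ℝ (y - x₀) a)
    (hzb : zb = inner ℝ (y - x₀) b) :
    HasDerivAt (fun t : ℝ => Fd p lam x₀ u b (y + t • a))
      ((lam ^ p / ‖y - x₀‖ ^ p) * (
        -p * za / s * (-(p * zb / s * u ξ) + lam ^ 2 / s *
          (fderiv ℝ u ξ b - 2 * zb / s * fderiv ℝ u ξ (y - x₀)))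
        - p * (inner ℝ a b / s - 2 * za * zb / s ^ 2) * u ξ
        - p * zb / s * (lam ^ 2 / s *
          (fderiv ℝ u ξ a - 2 * za / s * fderiv ℝ u ξ (y - x₀)))
        - 2 * lam ^ 2 * za / s ^ 2 * (fderiv ℝ u ξ b - 2 * zb / s * fderiv ℝ u ξ (y - x₀))
        + lam ^ 2 / s * (lam ^ 2 / s * (H a b - 2 * za / s * H (y - x₀) b)
          - 2 * (inner ℝ a b / s - 2 * za * zb / s ^ 2) * fderiv ℝ u ξ (y - x₀)
          - 2 * zb / s * (lam ^ 2 / s * (H a (y - x₀) - 2 * za / s * H (y - x₀) (y - x₀))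
            + fderiv ℝ u ξ a)))) 0 := by
  have hr : ‖y - x₀‖ ≠ 0 := norm_ne_zero_iff.2 (sub_ne_zero.2 hy)
  have hl : HasDerivAt (fun t : ℝ => y + t • a - x₀) a 0 := by
    simpa using (((hasDerivAt_id (0:ℝ)).smul_const a).const_add y).sub_const x₀
  have hin : HasDerivAt (fun t : ℝ => inner ℝ (y + t • a - x₀) b) (inner ℝ a b) 0 := by
    simpa using hl.inner ℝ (hasDerivAt_const (0:ℝ) b)
  have hD : DifferentiableAt ℝ (fderiv ℝ u) ξ :=
    (hu.fderiv_right (m := 1) (by norm_num)).differentiableAt (by norm_num)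
  have hG : HasDerivAt (fun t : ℝ =>
      fderiv ℝ u (x₀ + (lam ^ 2 / ‖y + t • a - x₀‖ ^ 2) • (y + t • a - x₀)))
      (fderiv ℝ (fderiv ℝ u) ξ ((lam ^ 2 / ‖y - x₀‖ ^ 2) •
        (a - (2 * inner ℝ (y - x₀) a / ‖y - x₀‖ ^ 2) • (y - x₀)))) 0 :=
    HasFDerivAt.comp_hasDerivAt_of_eq (0:ℝ) hD.hasFDerivAt (line_phi lam y a x₀ hy)
      (by simp [hξ])
  have hP := hG.clm_apply (hasDerivAt_const (0:ℝ) b)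
  have hQ := hG.clm_apply hl
  have hS := (line_sq y a x₀)
  have hS0 : ‖y + (0:ℝ) • a - x₀‖ ^ 2 ≠ 0 := by simpa using hr
  have hU := line_u lam y a x₀ hy u (hξ ▸ hu.differentiableAt (by norm_num))
  have hM := line_M p lam y a x₀ hy
  have hA := (((hin.const_mul (p:ℝ)).fun_div hS hS0).fun_mul hU).fun_neg
  have hB := ((hasDerivAt_const (0:ℝ) (lam^2)).fun_div hS hS0).fun_mul
    (hP.fun_sub (((hin.const_mul (2:ℝ)).fun_div hS hS0).fun_mul hQ))
  have := hM.fun_mul (hA.fun_add hB)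
  refine this.congr_deriv ?_
  have hs0 : s ≠ 0 := by rw [hs]; positivity
  simp only [zero_smul, add_zero, ← hξ]
  simp only [← hs, ← hza, ← hzb, hH]
  clear this hA hB hM hU hS0 hS hQ hP hG hin hl hH hξ hza hzb
  generalize y - x₀ = z at *
  simp only [map_smul, map_sub,
    _root_.smul_apply, _root_.sub_apply, smul_eq_mul, map_zero]
  field_simp
  ring

theorem second_fderiv (p : ℕ) (lam : ℝ) (y a b x₀ : E) (hy : y ≠ x₀) (u : E → ℝ)
    (ξ : E) (hξ : ξ = x₀ + (lam ^ 2 / ‖y - x₀‖ ^ 2) • (y - x₀))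
    (hu : ContDiffAt ℝ 2 u ξ) :
    fderiv ℝ (fun y => fderiv ℝ (fun z => (lam ^ p / ‖z - x₀‖ ^ p) *
      u (x₀ + (lam ^ 2 / ‖z - x₀‖ ^ 2) • (z - x₀))) y b) y a =
    deriv (fun t : ℝ => Fd p lam x₀ u b (y + t • a)) 0 := by
  have hw := contDiff_w p lam y x₀ hy u (hξ ▸ hu)
  have hD := ((hw.fderiv_right (m := 1) (by norm_num)).differentiableAt (by norm_num)).clm_apply
    (differentiableAt_const b)
  rw [← hD.lineDeriv_eq_fderiv, lineDeriv]
  apply Filter.EventuallyEq.deriv_eq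
  have hl : ContinuousAt (fun t : ℝ => y + t • a) 0 := by fun_prop
  have h1 : ∀ᶠ t in nhds (0:ℝ), y + t • a ≠ x₀ :=
    hl.eventually_ne (by simpa using hy)
  have h2 : ∀ᶠ t in nhds (0:ℝ), ContDiffAt ℝ 2 u
      (x₀ + (lam ^ 2 / ‖y + t • a - x₀‖ ^ 2) • (y + t • a - x₀)) := by
    have hc := (line_phi lam y a x₀ hy).continuousAt
    have he := hu.eventually (by simp)
    apply hc.eventually
    simpa [← hξ] using he
  filter_upwards [h1, h2] with t ht1 ht2
  exact first_fderiv p lam (y + t • a) b x₀ ht1 u ht2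

theorem refl_charpoly (n : ℕ) (z : EuclideanSpace ℝ (Fin n)) (hz : z ≠ 0)
    (B : EuclideanSpace ℝ (Fin n) →L[ℝ] EuclideanSpace ℝ (Fin n) →L[ℝ] ℝ)
    (A C : Matrix (Fin n) (Fin n) ℝ)
    (hA : ∀ i j, A i j = B (EuclideanSpace.single i 1) (EuclideanSpace.single j 1))
    (R : EuclideanSpace ℝ (Fin n) → EuclideanSpace ℝ (Fin n))
    (hR : R = fun v => v - (2 * inner ℝ z v / ‖z‖ ^ 2) • z)
    (hC : ∀ i j, C i j = B (R (EuclideanSpace.single i 1)) (R (EuclideanSpace.single j 1))) :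
    (-C).charpoly = (-A).charpoly := by
  have hr : ‖z‖ ≠ 0 := norm_ne_zero_iff.2 hz
  have hiso : ∀ v w, inner ℝ (R v) (R w) = inner ℝ v w := by
    intro v w
    simp only [hR, inner_sub_left, inner_sub_right, inner_smul_left, inner_smul_right,
      real_inner_self_eq_norm_sq, real_inner_comm z v, conj_trivial]
    field_simp
    ring
  have hsum : ∀ v : EuclideanSpace ℝ (Fin n), v = ∑ k, v k • EuclideanSpace.single k (1:ℝ) := by
    intro v
    simpa using ((EuclideanSpace.basisFun (Fin n) ℝ).sum_repr v).symm
  have hB : ∀ v w, B v w = ∑ l, (∑ k, v k * A k l) * w l := by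
    intro v w
    conv_lhs => rw [hsum v, hsum w]
    simp only [map_sum, map_smul, _root_.sum_apply, _root_.smul_apply, smul_eq_mul, hA,
      Finset.sum_mul, Finset.mul_sum]
    refine Finset.sum_congr rfl fun _ _ => Finset.sum_congr rfl fun _ _ => by ring
  let Q : Matrix (Fin n) (Fin n) ℝ := Matrix.of fun i j => R (EuclideanSpace.single i 1) j
  have hQ : Q * Qᵀ = 1 := by
    ext i j
    have := hiso (EuclideanSpace.single i 1) (EuclideanSpace.single j 1)
    rw [PiLp.inner_apply] at this
    simp only [Matrix.mul_apply, Q, Matrix.transpose_apply, Matrix.of_apply, Matrix.one_apply]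
    rw [EuclideanSpace.inner_single_left] at this
    simpa [mul_comm, PiLp.single_apply] using this
  have hCQ : C = Q * A * Qᵀ := by
    ext i j
    rw [hC, hB]
    simp [Matrix.mul_apply, Q]
  have h1 : -C = Q * (-A * Qᵀ) := by rw [hCQ]; simp [Matrix.mul_assoc]
  rw [h1, Matrix.charpoly_mul_comm, Matrix.mul_assoc, mul_eq_one_comm.1 hQ, Matrix.mul_one]

theorem sum_sq_dual (n : ℕ) (g : EuclideanSpace ℝ (Fin n)) :
    ∑ k, (inner ℝ g (EuclideanSpace.single k (1:ℝ))) ^ 2 = ‖g‖ ^ 2 := by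
  rw [EuclideanSpace.real_norm_sq_eq]
  simp [EuclideanSpace.inner_single_right]
theorem alg (p n U u M l s za zb ab ga gb gz G2 Hab Hzb Haz Hzz : ℝ) (hn : n = p + 2)
   (hp : p ≠ 0) (hu : u ≠ 0) (hM : M ≠ 0) (hl : l ≠ 0) (hs : s ≠ 0) :
   -(2 / (n-2)) * (U / (M * (l^2/s)^2)) * (M * (
        -p * za / s * (-(p * zb / s * u) + l ^ 2 / s *
          (gb - 2 * zb / s * gz))
        - p * (ab / s - 2 * za * zb / s ^ 2) * u
        - p * zb / s * (l ^ 2 / s *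
          (ga - 2 * za / s * gz))
        - 2 * l ^ 2 * za / s ^ 2 * (gb - 2 * zb / s * gz)
        + l ^ 2 / s * (l ^ 2 / s * (Hab - 2 * za / s * Hzb)
          - 2 * (ab / s - 2 * za * zb / s ^ 2) * gz
          - 2 * zb / s * (l ^ 2 / s * (Haz - 2 * za / s * Hzz)
            + ga))))
   + (2 * n / (n-2)^2) * (U / (M * (l^2/s)^2) / (M * u)) * 
      (M * (-(p * za / s * u) + l^2/s * (ga - 2 * za / s * gz))) *
      (M * (-(p * zb / s * u) + l^2/s * (gb - 2 * zb / s * gz)))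
   - (2 / (n-2)^2) * (U / (M * (l^2/s)^2) / (M * u)) *
      (M^2 * (p^2 * u^2 / s + (l^2/s)^2 * G2 + 2 * p * u * (l^2/s)/s * gz)) * ab
   = -(2 / (n-2)) * U * (Hab - 2 * za / s * Hzb - 2 * zb / s * Haz + 4 * za * zb / s^2 * Hzz)
    + (2 * n / (n-2)^2) * (U / u) * (ga - 2 * za / s * gz) * (gb - 2 * zb / s * gz)
    - (2 / (n-2)^2) * (U / u) * G2 * ab := by
  subst hn
  have : p + 2 - 2 = p := by ring
  rw [this]
  field_simp
  ring

end KelvinAux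

theorem rpow_aux1 (n : ℕ) (hn : 3 ≤ n) (x : ℝ) (hx : 0 < x) :
    x ^ (-(2 * (n : ℝ) / ((n : ℝ) - 2))) = x ^ (-(((n : ℝ) + 2) / ((n : ℝ) - 2))) / x := by
  rw [← Real.rpow_sub_one hx.ne']
  congr 1
  have : (n : ℝ) - 2 ≠ 0 := by
    have : (3:ℝ) ≤ n := by exact_mod_cast hn
    linarith
  field_simp
  ring

theorem rpow_aux2 (n : ℕ) (hn : 3 ≤ n) (lam r x : ℝ) (hl : 0 < lam) (hr : 0 < r) (hx : 0 < x) :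
    (lam ^ (n - 2) / r ^ (n - 2) * x) ^ (-(((n : ℝ) + 2) / ((n : ℝ) - 2))) =
      x ^ (-(((n : ℝ) + 2) / ((n : ℝ) - 2))) /
        (lam ^ (n - 2) / r ^ (n - 2) * (lam ^ 2 / r ^ 2) ^ 2) := by
  obtain ⟨p, rfl⟩ : ∃ p, n = p + 2 := ⟨n - 2, by omega⟩
  have hp : (p : ℝ) ≠ 0 := by
    have : p ≠ 0 := by omega
    exact_mod_cast this
  have hm : 0 < lam / r := by positivity
  simp only [Nat.add_sub_cancel, ← div_pow]
  push_cast
  rw [Real.mul_rpow (by positivity) hx.le, ← Real.rpow_natCast (lam / r) p, ← Real.rpow_mul hm.le]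
  have e : (p : ℝ) * -(((p : ℝ) + 2 + 2) / ((p : ℝ) + 2 - 2)) = -((p + 4 : ℕ) : ℝ) := by
    push_cast
    have : (p : ℝ) + 2 - 2 = p := by ring
    rw [this]
    field_simp
    ring
  rw [e, Real.rpow_neg hm.le, Real.rpow_natCast, Real.rpow_natCast, ← pow_mul, ← pow_add,
    inv_mul_eq_div]

/-- conformal invariance of `λ(-A^u)` under the Kelvin transform: the
eigenvalue multiset of `-A^{u_{x₀,λ}}` at `y` (encoded via the characteristic polynomial)
equals that of `-A^u` at the inverted point `ξ = x₀ + λ²(y-x₀)/|y-x₀|²`. -/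
theorem kelvin_transform_invariance
    (n : ℕ) (hn : 3 ≤ n) (Ω : Set (EuclideanSpace ℝ (Fin n))) (hΩ : IsOpen Ω)
    (u : EuclideanSpace ℝ (Fin n) → ℝ) (hu : ContDiffOn ℝ 2 u Ω)
    (hupos : ∀ x ∈ Ω, 0 < u x)
    (x₀ : EuclideanSpace ℝ (Fin n)) (lam : ℝ) (hlam : 0 < lam)
    (y : EuclideanSpace ℝ (Fin n)) (hy : y ≠ x₀)
    (hξ : x₀ + (lam ^ 2 / ‖y - x₀‖ ^ 2) • (y - x₀) ∈ Ω) :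
    (-(confHess n
        (fun z => (lam ^ (n - 2) / ‖z - x₀‖ ^ (n - 2)) *
          u (x₀ + (lam ^ 2 / ‖z - x₀‖ ^ 2) • (z - x₀))) y)).charpoly
      = (-(confHess n u (x₀ + (lam ^ 2 / ‖y - x₀‖ ^ 2) • (y - x₀)))).charpoly := by
  set z := y - x₀ with hzdef
  set ξ := x₀ + (lam ^ 2 / ‖z‖ ^ 2) • z with hξdef
  have hz : z ≠ 0 := sub_ne_zero.2 hy
  have hr : 0 < ‖z‖ := norm_pos_iff.2 hz
  have huξ : ContDiffAt ℝ 2 u ξ := hu.contDiffAt (hΩ.mem_nhds hξ)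
  have hpos : 0 < u ξ := hupos ξ hξ
  obtain ⟨p, rfl⟩ : ∃ p, n = p + 2 := ⟨n - 2, by omega⟩
  have hp : (p : ℝ) ≠ 0 := by
    have : p ≠ 0 := by omega
    exact_mod_cast this
  obtain ⟨g, hg⟩ : ∃ g : EuclideanSpace ℝ (Fin (p + 2)), ∀ v, fderiv ℝ u ξ v = inner ℝ g v :=
    ⟨(InnerProductSpace.toDual ℝ _).symm (fderiv ℝ u ξ), fun v => by simp⟩
  have hDD : DifferentiableAt ℝ (fderiv ℝ u) ξ :=
    (huξ.fderiv_right (m := 1) (by norm_num)).differentiableAt (by norm_num)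
  have hhess : ∀ i j, phess (p + 2) u ξ i j = fderiv ℝ (fderiv ℝ u) ξ
      (EuclideanSpace.single i 1) (EuclideanSpace.single j 1) := by
    intro i j
    unfold phess
    rw [fderiv_clm_apply hDD (differentiableAt_const _)]
    simp
  have hgu : ∑ k, (pgrad (p + 2) u ξ k) ^ 2 = ‖g‖ ^ 2 := by
    simp only [pgrad, hg]
    exact sum_sq_dual _ g
  set U := (u ξ) ^ (-((((p + 2 : ℕ) : ℝ) + 2) / (((p + 2 : ℕ) : ℝ) - 2))) with hU
  set nr : ℝ := ((p + 2 : ℕ) : ℝ) with hnr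
  have hnr' : nr = p + 2 := by rw [hnr]; push_cast; ring
  obtain ⟨I, hI⟩ : ∃ I : EuclideanSpace ℝ (Fin (p + 2)) →L[ℝ] EuclideanSpace ℝ (Fin (p + 2)) →L[ℝ] ℝ,
      ∀ a b, I a b = inner ℝ a b := ⟨innerSL ℝ, fun a b => rfl⟩
  let B : EuclideanSpace ℝ (Fin (p + 2)) →L[ℝ] EuclideanSpace ℝ (Fin (p + 2)) →L[ℝ] ℝ :=
    (-(2 / (nr - 2)) * U) • fderiv ℝ (fderiv ℝ u) ξ
    + ((2 * nr / (nr - 2) ^ 2) * (U / u ξ)) • (fderiv ℝ u ξ).smulRight (fderiv ℝ u ξ)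
    - ((2 / (nr - 2) ^ 2) * (U / u ξ) * ‖g‖ ^ 2) • I
  have hB : ∀ a b, B a b = -(2 / (nr - 2)) * U * fderiv ℝ (fderiv ℝ u) ξ a b
      + (2 * nr / (nr - 2) ^ 2) * (U / u ξ) * inner ℝ g a * inner ℝ g b
      - (2 / (nr - 2) ^ 2) * (U / u ξ) * ‖g‖ ^ 2 * inner ℝ a b := by
    intro a b
    simp [B, hg, hI]
    ring
  have hone : ∀ i j : Fin (p + 2), inner ℝ (EuclideanSpace.single i (1:ℝ))
      (EuclideanSpace.single j (1:ℝ)) = if i = j then (1:ℝ) else 0 := by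
    intro i j
    rw [EuclideanSpace.inner_single_left]
    simp [PiLp.single_apply]
  refine refl_charpoly (p + 2) z hz B _ _ ?_ _ rfl ?_
  · intro i j
    rw [hB]
    simp only [confHess, Matrix.of_apply, hgu, hhess, rpow_aux1 (p + 2) hn _ hpos, hone]
    simp only [pgrad, hg]
    rfl
  · intro i j
    set M := lam ^ p / ‖z‖ ^ p with hM
    have hMpos : 0 < M := by positivity
    have hfirst : ∀ a, fderiv ℝ (fun z => (lam ^ p / ‖z - x₀‖ ^ p) *
        u (x₀ + (lam ^ 2 / ‖z - x₀‖ ^ 2) • (z - x₀))) y a =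
        M * (-(p * inner ℝ z a / ‖z‖ ^ 2 * u ξ) + lam ^ 2 / ‖z‖ ^ 2 *
          (inner ℝ g a - 2 * inner ℝ z a / ‖z‖ ^ 2 * inner ℝ g z)) := by
      intro a
      rw [first_fderiv p lam y a x₀ hy u huξ, ← hg, ← hg]
      rfl
    have hsq : ∑ k, (pgrad (p + 2) (fun z => (lam ^ p / ‖z - x₀‖ ^ p) *
        u (x₀ + (lam ^ 2 / ‖z - x₀‖ ^ 2) • (z - x₀))) y k) ^ 2 =
        M ^ 2 * (p ^ 2 * (u ξ) ^ 2 / ‖z‖ ^ 2 + (lam ^ 2 / ‖z‖ ^ 2) ^ 2 * ‖g‖ ^ 2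
          + 2 * p * u ξ * (lam ^ 2 / ‖z‖ ^ 2) / ‖z‖ ^ 2 * inner ℝ g z) := by
      have hgw : ∀ a, M * (-(p * inner ℝ z a / ‖z‖ ^ 2 * u ξ) + lam ^ 2 / ‖z‖ ^ 2 *
          (inner ℝ g a - 2 * inner ℝ z a / ‖z‖ ^ 2 * inner ℝ g z)) =
          inner ℝ (M • ((-(p * u ξ / ‖z‖ ^ 2)) • z + (lam ^ 2 / ‖z‖ ^ 2) •
            (g - (2 * inner ℝ g z / ‖z‖ ^ 2) • z))) a := by
        intro a
        simp only [inner_smul_left, inner_add_left, inner_sub_left, conj_trivial]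
        ring
      simp only [pgrad, hfirst, hgw]
      rw [sum_sq_dual, ← real_inner_self_eq_norm_sq]
      simp only [inner_smul_left, inner_add_left, inner_sub_left, conj_trivial,
        inner_smul_right, inner_add_right, inner_sub_right, real_inner_self_eq_norm_sq,
        real_inner_comm g z]
      field_simp
      ring
    have hsec : phess (p + 2) (fun z => (lam ^ p / ‖z - x₀‖ ^ p) *
        u (x₀ + (lam ^ 2 / ‖z - x₀‖ ^ 2) • (z - x₀))) y i j = _ :=
      (second_fderiv p lam y (EuclideanSpace.single i 1) (EuclideanSpace.single j 1) x₀ hy u ξ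
        rfl huξ).trans (line_Fd p lam y (EuclideanSpace.single i 1)
        (EuclideanSpace.single j 1) x₀ hy u ξ rfl huξ _ rfl _ _ _ rfl rfl rfl).deriv
    have hr2 := rpow_aux2 (p + 2) hn lam ‖z‖ (u ξ) hlam hr hpos
    have hwpos : 0 < M * u ξ := by positivity
    simp only [Nat.add_sub_cancel] at hr2 ⊢
    rw [← hM, ← hU] at hr2
    have key := alg p nr U (u ξ) M lam (‖z‖ ^ 2) (inner ℝ z (EuclideanSpace.single i 1))
      (inner ℝ z (EuclideanSpace.single j 1))
      (inner ℝ (EuclideanSpace.single i (1:ℝ)) (EuclideanSpace.single j (1:ℝ)))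
      (inner ℝ g (EuclideanSpace.single i 1)) (inner ℝ g (EuclideanSpace.single j 1))
      (inner ℝ g z) (‖g‖ ^ 2)
      (fderiv ℝ (fderiv ℝ u) ξ (EuclideanSpace.single i 1) (EuclideanSpace.single j 1))
      (fderiv ℝ (fderiv ℝ u) ξ z (EuclideanSpace.single j 1))
      (fderiv ℝ (fderiv ℝ u) ξ (EuclideanSpace.single i 1) z)
      (fderiv ℝ (fderiv ℝ u) ξ z z) hnr' hp hpos.ne' hMpos.ne' hlam.ne' (by positivity)
    rw [hB]
    unfold confHess
    rw [Matrix.of_apply, hsq, hsec]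
    simp only [pgrad, hfirst]
    rw [← hzdef, ← hξdef, ← hM, ← hnr, rpow_aux1 (p + 2) hn _ hwpos, hr2, ← hone]
    simp only [hg]
    refine key.trans ?_
    simp only [map_smul, map_sub, _root_.smul_apply, _root_.sub_apply, smul_eq_mul,
      inner_sub_left, inner_sub_right, inner_smul_left, inner_smul_right, conj_trivial,
      real_inner_self_eq_norm_sq]
    rw [real_inner_comm z (EuclideanSpace.single i 1)]
    field_simp
    ring
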